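/- The generating function for convex (n,b)-domino towers factors as C_b(x) = (G_b(x) + 1)(2R_b(x) + H_b(x)), where the widest row of the tower has b dominoes. -/

import Mathlib

/-- The dominoes of `D` at level `y`, identified by the x-coordinate of their left cell. -/
def rowSet (D : Finset (ℤ × ℕ)) (y : ℕ) : Finset ℤ :=
  (D.filter (fun p => p.2 = y)).image Prod.fst

/-- Dominoes at the same level do not overlap. -/
def NoOverlap (D : Finset (ℤ × ℕ)) : Prop :=
  ∀ p ∈ D, (p.1 + 1, p.2) ∉ D

/-- Every domino above the base is supported by a domino one level below,
at horizontal offset `-1`, `0`, or `+1`. -/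
def Supported (D : Finset (ℤ × ℕ)) : Prop :=
  ∀ (x : ℤ) (y : ℕ), (x, y + 1) ∈ D →
    (x - 1, y) ∈ D ∨ (x, y) ∈ D ∨ (x + 1, y) ∈ D

/-- The unit cell `(x, y)` is covered by some domino of `D`. -/
def Covered (D : Finset (ℤ × ℕ)) (x : ℤ) (y : ℕ) : Prop :=
  (x, y) ∈ D ∨ (x - 1, y) ∈ D

/-- `D` is a convex `(n,b)`-domino tower: a domino tower of `n` dominoes on a convex
(contiguous) horizontal base (normalized to start at `x = 0`) which is convex as a
polyomino (all rows and all columns of cells are contiguous), and whose widest row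
consists of `b` dominoes. -/
def IsConvexDominoTower (n b : ℕ) (D : Finset (ℤ × ℕ)) : Prop :=
  D.card = n ∧ NoOverlap D ∧ Supported D ∧
  (∃ b0 : ℕ, 1 ≤ b0 ∧ rowSet D 0 = (Finset.range b0).image (fun t : ℕ => 2 * (t : ℤ))) ∧
  (∀ (x₁ x₂ x : ℤ) (y : ℕ), Covered D x₁ y → Covered D x₂ y → x₁ ≤ x → x ≤ x₂ →
    Covered D x y) ∧
  (∀ (x : ℤ) (y₁ y₂ y : ℕ), Covered D x y₁ → Covered D x y₂ → y₁ ≤ y → y ≤ y₂ →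
    Covered D x y) ∧
  (∃ y, (rowSet D y).card = b) ∧ (∀ y, (rowSet D y).card ≤ b)

/-- `gFun b n` is the number of supporting `(n,b)`-domino towers. -/
def gFun : ℕ → ℕ → ℕ
  | b, n =>
    if b < 2 ∨ n + 1 < b then 0
    else if n + 1 = b then 1
    else gFun b (n + 1 - b) + gFun (b - 1) (n + 1 - b)
termination_by b n => n
decreasing_by all_goals omega

/-- `hFun b n` is the number of `(n,b)`-domino stacks. -/
def hFun : ℕ → ℕ → ℕ
  | b, n =>
    if b = 0 ∨ n ≤ b then (if n = b ∧ 1 ≤ b then 1 else 0)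
    else ∑ i ∈ Finset.Icc 1 b, (2 * (b - i) + 1) * hFun i (n - b)
termination_by b n => n
decreasing_by omega

/-- `rFun b n` is the number of right-skewed `(n,b)`-domino towers. -/
def rFun : ℕ → ℕ → ℕ
  | b, n =>
    if b = 0 ∨ n ≤ b + 1 then (if n = b + 1 ∧ 1 ≤ b then 1 else 0)
    else ∑ i ∈ Finset.Icc 1 b, (2 * rFun i (n - b) + hFun i (n - b))
termination_by b n => n
decreasing_by omega

/-- The list of rows `(left end, number of dominoes)` reaches further left than its first row. -/
def OverhangsLeft : List (ℤ × ℕ) → Prop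
  | [] => False
  | [_] => False
  | R :: S :: L => S.1 < R.1 ∨ OverhangsLeft (S :: L)

/-- The list of rows `(left end, number of dominoes)` reaches further right than its first row. -/
def OverhangsRight : List (ℤ × ℕ) → Prop
  | [] => False
  | [_] => False
  | R :: S :: L => R.1 + 2 * R.2 < S.1 + 2 * S.2 ∨ OverhangsRight (S :: L)

/-- The list of rows, from bottom to top, describes a convex domino tower. -/
def IsTowerRows : List (ℤ × ℕ) → Prop
  | [] => False
  | [R] => 1 ≤ R.2
  | R :: S :: L => 1 ≤ R.2 ∧ R.1 ≤ S.1 + 1 ∧ S.1 + 2 * S.2 ≤ R.1 + 2 * R.2 + 1 ∧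
      (OverhangsLeft (S :: L) → S.1 ≤ R.1) ∧
      (OverhangsRight (S :: L) → R.1 + 2 * R.2 ≤ S.1 + 2 * S.2) ∧ IsTowerRows (S :: L)

/-- The number of dominoes in a list of rows. -/
def rowsSize : List (ℤ × ℕ) → ℕ
  | [] => 0
  | R :: L => R.2 + rowsSize L

/-- The number of dominoes in a widest row. -/
def maxRow : List (ℤ × ℕ) → ℕ
  | [] => 0
  | R :: L => max R.2 (maxRow L)

theorem IsTowerRows.one_le {R : ℤ × ℕ} {L : List (ℤ × ℕ)} (h : IsTowerRows (R :: L)) :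
    1 ≤ R.2 := by
  cases L with
  | nil => exact h
  | cons S L => exact h.1

theorem IsTowerRows.widest {R : ℤ × ℕ} {L : List (ℤ × ℕ)} (h : IsTowerRows (R :: L)) :
    (OverhangsLeft (R :: L) ∧ OverhangsRight (R :: L) → R.2 < maxRow (R :: L)) ∧
      (¬(OverhangsLeft (R :: L) ∧ OverhangsRight (R :: L)) → maxRow (R :: L) = R.2) := by
  induction L generalizing R with
  | nil => simp [OverhangsLeft, maxRow]
  | cons S L ih =>
    obtain ⟨h1, h2, h3, h4, h5, h6⟩ := h
    have := ih h6
    rw [maxRow]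
    simp only [OverhangsLeft, OverhangsRight]
    generalize maxRow (S :: L) = m at *
    by_cases hl : OverhangsLeft (S :: L) <;> by_cases hr : OverhangsRight (S :: L) <;>
      simp only [hl, hr, true_and, and_true, and_false, or_true, or_false, not_true_eq_false,
        not_false_eq_true, forall_const, IsEmpty.forall_iff] at * <;>
      omega

/-- Towers with first row `R` and `n` dominoes that satisfy `P`. -/
def runs (P : List (ℤ × ℕ) → Prop) (R : ℤ × ℕ) (n : ℕ) : Set (List (ℤ × ℕ)) :=
  {L | ∃ L', L = R :: L' ∧ IsTowerRows L ∧ P L ∧ rowsSize L = n}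

theorem encard_biUnion_finset {α ι : Type*} (J : Finset ι) (s : ι → Set α)
    (h : (J : Set ι).PairwiseDisjoint s) :
    (⋃ i ∈ J, s i).encard = ∑ i ∈ J, (s i).encard := by
  rw [← finsum_mem_coe_finset, ← J.finite_toSet.encard_biUnion h]
  simp

theorem runs_encard_eq_sum {ι : Type*} {P : List (ℤ × ℕ) → Prop} {R : ℤ × ℕ} {n : ℕ}
    (hn : R.2 < n) (J : Finset ι) (S : ι → ℤ × ℕ) (Q : ι → List (ℤ × ℕ) → Prop)
    (hdisj : ∀ i ∈ J, ∀ j ∈ J, ∀ L, S i = S j → Q i (S i :: L) → Q j (S i :: L) → i = j)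
    (hstep : ∀ T L, IsTowerRows (R :: T :: L) ∧ P (R :: T :: L) ↔
      ∃ j ∈ J, S j = T ∧ IsTowerRows (T :: L) ∧ Q j (T :: L)) :
    (runs P R n).encard = ∑ j ∈ J, (runs (Q j) (S j) (n - R.2)).encard := by
  have hU : runs P R n = ⋃ j ∈ J, List.cons R '' runs (Q j) (S j) (n - R.2) := by
    ext L
    simp only [Set.mem_iUnion, Set.mem_image, runs, Set.mem_ofPred_eq, exists_prop]
    constructor
    · rintro ⟨L', rfl, h1, h2, h3⟩
      cases L' with
      | nil => simp [rowsSize] at h3; omega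
      | cons T L' =>
        obtain ⟨j, hj, rfl, h4, h5⟩ := (hstep T L').1 ⟨h1, h2⟩
        refine ⟨j, hj, _, ⟨L', rfl, h4, h5, ?_⟩, rfl⟩
        rw [rowsSize] at h3
        omega
    · rintro ⟨j, hj, _, ⟨L', rfl, h1, h2, h3⟩, rfl⟩
      obtain ⟨h4, h5⟩ := (hstep (S j) L').2 ⟨j, hj, rfl, h1, h2⟩
      refine ⟨_, rfl, h4, h5, ?_⟩
      rw [rowsSize, h3]
      omega
  rw [hU, encard_biUnion_finset]
  · exact Finset.sum_congr rfl fun j _ => (List.cons_injective).encard_image _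
  · intro i hi j hj hij
    refine Set.disjoint_left.2 ?_
    rintro _ ⟨_, ⟨L, rfl, h1, h2, h3⟩, rfl⟩ ⟨_, ⟨L', rfl, h1', h2', h3'⟩, h⟩
    simp only [List.cons.injEq, true_and] at h
    obtain ⟨h, rfl⟩ := h
    exact hij (hdisj i hi j hj L' h.symm h2 (h ▸ h2'))

theorem runs_of_le {P : List (ℤ × ℕ) → Prop} {R : ℤ × ℕ} {n : ℕ} (hn : n ≤ R.2) :
    runs P R n = {L | L = [R] ∧ 1 ≤ R.2 ∧ P [R] ∧ n = R.2} := by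
  ext L
  simp only [runs, Set.mem_ofPred_eq]
  constructor
  · rintro ⟨L', rfl, h1, h2, h3⟩
    cases L' with
    | nil => exact ⟨rfl, h1, h2, by simpa [rowsSize] using h3.symm⟩
    | cons T L' =>
      have := h1.2.2.2.2.2.one_le
      simp only [rowsSize] at h3
      omega
  · rintro ⟨rfl, h1, h2, h3⟩
    exact ⟨[], rfl, h1, h2, by simpa [rowsSize] using h3.symm⟩

/-- Every row is contained in the row below. -/
def IsStackRows (L : List (ℤ × ℕ)) : Prop := ¬OverhangsLeft L ∧ ¬OverhangsRight L

/-- Only the right end moves beyond the first row. -/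
def IsRightSkewedRows (L : List (ℤ × ℕ)) : Prop := ¬OverhangsLeft L ∧ OverhangsRight L

/-- Only the left end moves beyond the first row. -/
def IsLeftSkewedRows (L : List (ℤ × ℕ)) : Prop := OverhangsLeft L ∧ ¬OverhangsRight L

theorem encard_runs_stack (n w : ℕ) (a : ℤ) :
    (runs IsStackRows (a, w) n).encard = hFun w n := by
  induction n using Nat.strong_induction_on generalizing w a with
  | _ n ih =>
  rw [hFun]
  split_ifs with h1 h2
  · rw [runs_of_le (by simp; omega)]
    simp [IsStackRows, OverhangsLeft, OverhangsRight, h2]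
  · rcases h1 with rfl | h1
    · rw [Nat.cast_zero, Set.encard_eq_zero, Set.eq_empty_iff_forall_notMem]
      rintro _ ⟨L, rfl, h, -⟩
      simpa using h.one_le
    · rw [runs_of_le (by simpa using h1)]
      have : ¬(1 ≤ w ∧ n = w) := by tauto
      simp only [Nat.cast_zero, Set.encard_eq_zero, Set.eq_empty_iff_forall_notMem,
        Set.mem_ofPred_eq]
      tauto
  · rw [runs_encard_eq_sum (ι := (_ : ℕ) × ℕ) (by simp; omega)
      ((Finset.Icc 1 w).sigma fun i => Finset.range (2 * (w - i) + 1))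
      (fun j => (a + j.2, j.1)) (fun _ => IsStackRows), Finset.sum_sigma]
    · push_cast
      refine Finset.sum_congr rfl fun i hi => ?_
      simp only [Finset.mem_Icc] at hi
      rw [Finset.sum_congr rfl fun (t : ℕ) _ => ih (n - w) (by omega) i (a + t)]
      simp
    · rintro ⟨i, t⟩ - ⟨i', t'⟩ - L h - -
      simp at h
      simp [h]
    · rintro ⟨c, i⟩ L
      simp only [IsStackRows, OverhangsLeft, OverhangsRight, IsTowerRows, Finset.mem_sigma,
        Finset.mem_Icc, Finset.mem_range, Prod.mk.injEq]
      constructor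
      · rintro ⟨⟨h1, h2, h3, h4, h5, h6⟩, h7⟩
        have := h6.one_le
        refine ⟨⟨i, (c - a).toNat⟩, ?_, ?_, ?_⟩
        · dsimp at *
          omega
        · dsimp at *
          omega
        · tauto
      · rintro ⟨⟨i', t⟩, h1, ⟨rfl, rfl⟩, h3, h4, h5⟩
        dsimp at *
        refine ⟨⟨by omega, by omega, by omega, by tauto, by tauto, h3⟩, ?_, ?_⟩ <;>
        · rintro (h | h)
          · omega
          · tauto

theorem encard_runs_rightSkewed (n w : ℕ) (r : ℤ) :
    (runs IsRightSkewedRows (r - 2 * w, w) n).encard = rFun w n := by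
  induction n using Nat.strong_induction_on generalizing w r with
  | _ n ih =>
  have hsmall : n ≤ w → runs IsRightSkewedRows (r - 2 * w, w) n = ∅ := by
    intro h
    rw [runs_of_le (by simpa using h)]
    simp [IsRightSkewedRows, OverhangsRight]
  have hlarge : w ≠ 0 → w < n → (runs IsRightSkewedRows (r - 2 * w, w) n).encard =
      ((∑ i ∈ Finset.Icc 1 w, (2 * rFun i (n - w) + hFun i (n - w)) : ℕ) : ℕ∞) := by
    intro hw hn
    rw [runs_encard_eq_sum (ι := ℕ × Fin 3) (by simpa using hn)
      (Finset.Icc 1 w ×ˢ Finset.univ)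
      (fun j => ((![r, r + 1, r + 1] j.2 : ℤ) - 2 * j.1, j.1))
      (fun j => ![IsRightSkewedRows, IsRightSkewedRows, IsStackRows] j.2), Finset.sum_product]
    · push_cast
      refine Finset.sum_congr rfl fun i hi => ?_
      simp only [Finset.mem_Icc] at hi
      rw [Fin.sum_univ_three]
      simp only [Matrix.cons_val_zero, Matrix.cons_val_one, Matrix.cons_val]
      rw [ih _ (by omega), ih _ (by omega), encard_runs_stack]
      ring
    · rintro ⟨i, k⟩ - ⟨i', k'⟩ - L h h1 h2
      simp only [Prod.mk.injEq] at h ⊢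
      obtain ⟨h, rfl⟩ := h
      refine ⟨rfl, ?_⟩
      fin_cases k <;> fin_cases k' <;>
        simp [IsRightSkewedRows, IsStackRows] at h h1 h2 ⊢ <;> tauto
    · rintro ⟨c, i⟩ L
      simp only [OverhangsLeft, OverhangsRight, IsTowerRows, Finset.mem_product,
        Finset.mem_Icc, Finset.mem_univ, and_true, Prod.mk.injEq, Prod.exists,
        Fin.exists_fin_succ, Fin.succ_zero_eq_one, Fin.succ_one_eq_two,
        Matrix.cons_val_zero, Matrix.cons_val_one, Matrix.cons_val, IsRightSkewedRows, IsStackRows]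
      constructor
      · rintro ⟨⟨h1, h2, h3, h4, h5, h6⟩, h7, h8⟩
        have := h6.one_le
        refine ⟨i, ?_⟩
        by_cases hl : OverhangsLeft ((c, i) :: L) <;>
          by_cases hr : OverhangsRight ((c, i) :: L) <;>
          simp [hl, hr, h6] at * <;> omega
      · rintro ⟨i', h⟩
        by_cases hl : OverhangsLeft ((c, i) :: L) <;>
          by_cases hr : OverhangsRight ((c, i) :: L) <;>
          simp [hl, hr] at * <;> grind
  rw [rFun]
  split_ifs with h1 h2
  · obtain ⟨rfl, hw⟩ := h2
    rw [hlarge (by omega) (by omega), Nat.cast_inj]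
    have h0 : ∀ i, rFun i 1 = 0 := by
      intro i
      rw [rFun]
      split_ifs <;> first | rfl | omega
    have h3 : ∀ i, hFun i 1 = if i = 1 then 1 else 0 := by
      intro i
      rw [hFun]
      split_ifs <;> first | rfl | omega
    simp [h0, h3, hw]
  · by_cases hw : w = 0
    · subst hw
      rw [Nat.cast_zero (R := ℕ∞), Set.encard_eq_zero, Set.eq_empty_iff_forall_notMem]
      rintro _ ⟨L, rfl, h, -⟩
      simpa using h.one_le
    · rw [hsmall (by omega)]
      simp
  · exact hlarge (by omega) (by omega)

/-- Reflection of a row in the vertical axis. -/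
def mirrorRow (R : ℤ × ℕ) : ℤ × ℕ := (-R.1 - 2 * R.2, R.2)

theorem mirrorRow_mirrorRow (R : ℤ × ℕ) : mirrorRow (mirrorRow R) = R := by
  ext <;> simp [mirrorRow]

theorem map_mirrorRow_involutive : Function.Involutive (List.map mirrorRow) := by
  intro L
  induction L with
  | nil => rfl
  | cons R L ih => simp [mirrorRow_mirrorRow, Function.comp_def]

theorem overhangsLeft_map_mirrorRow (L : List (ℤ × ℕ)) :
    OverhangsLeft (L.map mirrorRow) ↔ OverhangsRight L := by
  induction L with
  | nil => rfl
  | cons R L ih =>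
    cases L with
    | nil => rfl
    | cons S L =>
      simp only [List.map_cons, OverhangsLeft, OverhangsRight, mirrorRow] at ih ⊢
      rw [ih]
      exact or_congr_left (by omega)

theorem overhangsRight_map_mirrorRow (L : List (ℤ × ℕ)) :
    OverhangsRight (L.map mirrorRow) ↔ OverhangsLeft L := by
  rw [← overhangsLeft_map_mirrorRow, map_mirrorRow_involutive]

theorem IsTowerRows.map_mirrorRow {L : List (ℤ × ℕ)} (h : IsTowerRows L) :
    IsTowerRows (L.map mirrorRow) := by
  induction L with
  | nil => exact h
  | cons R L ih =>
    cases L with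
    | nil => exact h
    | cons S L =>
      obtain ⟨h1, h2, h3, h4, h5, h6⟩ := h
      have hl := overhangsLeft_map_mirrorRow (S :: L)
      have hr := overhangsRight_map_mirrorRow (S :: L)
      have := ih h6
      simp only [List.map_cons] at hl hr this
      simp only [List.map_cons, IsTowerRows, hl, hr]
      refine ⟨h1, ?_, ?_, fun h => ?_, fun h => ?_, this⟩
      · simp only [mirrorRow]; omega
      · simp only [mirrorRow]; omega
      · have := h5 h
        simp only [mirrorRow]; omega
      · have := h4 h
        simp only [mirrorRow]; omega

theorem rowsSize_map_mirrorRow (L : List (ℤ × ℕ)) : rowsSize (L.map mirrorRow) = rowsSize L := by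
  induction L with
  | nil => rfl
  | cons R L ih => simp [rowsSize, ih, mirrorRow]

theorem encard_runs_leftSkewed (n : ℕ) (R : ℤ × ℕ) :
    (runs IsLeftSkewedRows R n).encard = rFun R.2 n := by
  rw [← encard_runs_rightSkewed n R.2 (-R.1),
    ← map_mirrorRow_involutive.injective.encard_image]
  congr 1
  have key : ∀ P Q : List (ℤ × ℕ) → Prop, (∀ L, P L → Q (L.map mirrorRow)) → ∀ S L,
      L ∈ runs P S n → L.map mirrorRow ∈ runs Q (mirrorRow S) n := by
    rintro P Q hPQ S _ ⟨L, rfl, h1, h2, h3⟩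
    exact ⟨L.map mirrorRow, by simp, h1.map_mirrorRow, hPQ _ h2,
      (rowsSize_map_mirrorRow _).trans h3⟩
  have hR : (-R.1 - 2 * R.2, R.2) = mirrorRow R := rfl
  rw [hR]
  ext L
  constructor
  · rintro ⟨L, hL, rfl⟩
    refine key IsLeftSkewedRows IsRightSkewedRows (fun L h => ?_) _ _ hL
    rwa [IsRightSkewedRows, overhangsLeft_map_mirrorRow, overhangsRight_map_mirrorRow, and_comm]
  · intro hL
    refine ⟨L.map mirrorRow, ?_, map_mirrorRow_involutive L⟩
    rw [← mirrorRow_mirrorRow R]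
    refine key IsRightSkewedRows IsLeftSkewedRows (fun L h => ?_) _ _ hL
    rwa [IsLeftSkewedRows, overhangsLeft_map_mirrorRow, overhangsRight_map_mirrorRow, and_comm]

/-- The number of convex towers with `n` dominoes whose first row has `w` dominoes and whose
widest row has `b` dominoes. -/
def convexCount (b : ℕ) : ℕ → ℕ → ℕ
  | w, n =>
    if w = b then 2 * rFun b n + hFun b n
    else if w = 0 ∨ n ≤ w then 0
    else convexCount b w (n - w) + convexCount b (w + 1) (n - w)
termination_by _ n => n
decreasing_by all_goals omega

theorem encard_runs_widest (b n : ℕ) (a : ℤ) :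
    (runs (fun L => maxRow L = b) (a, b) n).encard = (2 * rFun b n + hFun b n : ℕ) := by
  have hU : runs (fun L => maxRow L = b) (a, b) n =
      (runs IsRightSkewedRows (a, b) n ∪ runs IsLeftSkewedRows (a, b) n) ∪
        runs IsStackRows (a, b) n := by
    ext L
    simp only [runs, Set.mem_union, Set.mem_ofPred_eq]
    constructor
    · rintro ⟨L, rfl, h1, h2, h3⟩
      have := h1.widest.1
      dsimp only at this
      have : ¬ (OverhangsLeft ((a, b) :: L) ∧ OverhangsRight ((a, b) :: L)) := by
        intro h
        have := this h
        omega
      simp only [IsStackRows, IsRightSkewedRows, IsLeftSkewedRows, List.cons.injEq, true_and,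
        exists_eq_left', h1, h3]
      tauto
    · rintro ((⟨L, rfl, h1, h2, h3⟩ | ⟨L, rfl, h1, h2, h3⟩) | ⟨L, rfl, h1, h2, h3⟩)
      all_goals
        refine ⟨L, rfl, h1, h1.widest.2 fun h => ?_, h3⟩
        simp only [IsStackRows, IsRightSkewedRows, IsLeftSkewedRows] at h2
        tauto
  rw [hU, Set.encard_union_eq, Set.encard_union_eq, encard_runs_stack, encard_runs_leftSkewed]
  · have := encard_runs_rightSkewed n b (a + 2 * b)
    rw [add_sub_cancel_right] at this
    rw [this]
    push_cast
    ring
  · rw [Set.disjoint_left]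
    rintro _ ⟨L, -, -, h, -⟩ ⟨L', -, -, h', -⟩
    exact h.1 h'.1
  · rw [Set.disjoint_left]
    rintro _ (⟨L, -, -, h, -⟩ | ⟨L, -, -, h, -⟩) ⟨L', -, -, h', -⟩
    · exact h'.2 h.2
    · exact h'.1 h.1

theorem encard_runs_maxRow {b : ℕ} (n w : ℕ) (a : ℤ) (hw : w ≤ b) :
    (runs (fun L => maxRow L = b) (a, w) n).encard = convexCount b w n := by
  induction n using Nat.strong_induction_on generalizing w a with
  | _ n ih =>
  rw [convexCount]
  split_ifs with h1 h2
  · subst h1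
    exact encard_runs_widest w n a
  · rw [Nat.cast_zero (R := ℕ∞), Set.encard_eq_zero, Set.eq_empty_iff_forall_notMem]
    rcases h2 with rfl | h2
    · rintro _ ⟨L, rfl, h, -⟩
      simpa using h.one_le
    · rw [runs_of_le (by simpa using h2)]
      rintro _ ⟨rfl, -, h, -⟩
      simp [maxRow] at h
      omega
  · rw [runs_encard_eq_sum (ι := Bool) (by simp; omega) Finset.univ
      (fun j => if j then (a, w) else (a - 1, w + 1)) (fun _ L => maxRow L = b)]
    · simp only [Fintype.sum_bool, if_true, Bool.false_eq_true, if_false]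
      rw [ih _ (by omega) _ _ hw, ih _ (by omega) _ _ (by omega)]
      push_cast
      rfl
    · rintro (_ | _) - (_ | _) - L h - - <;> simp at h ⊢
    · rintro ⟨c, i⟩ L
      have hM : maxRow ((a, w) :: (c, i) :: L) = max w (maxRow ((c, i) :: L)) := rfl
      constructor
      · rintro ⟨h, hb⟩
        have hW := h.widest
        obtain ⟨h1, h2, h3, h4, h5, h6⟩ := h
        have := h6.widest
        have := h6.one_le
        rw [hb] at hW
        rw [hM] at hb
        simp only [Finset.mem_univ, true_and, Bool.exists_bool, if_true, Bool.false_eq_true,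
          if_false, Prod.mk.injEq, h6]
        simp only [OverhangsLeft, OverhangsRight] at hW
        generalize maxRow ((c, i) :: L) = m at *
        by_cases hl : OverhangsLeft ((c, i) :: L) <;>
          by_cases hr : OverhangsRight ((c, i) :: L) <;>
          simp only [hl, hr, true_and, and_true, and_false, or_true, or_false,
            not_true_eq_false, not_false_eq_true, forall_const, IsEmpty.forall_iff] at * <;>
          omega
      · rintro ⟨j, -, hj, h6, hb⟩
        have := h6.widest
        rw [hb] at this
        rw [hM, hb]
        simp only [IsTowerRows, h6]
        cases j <;>
        · simp only [if_true, Bool.false_eq_true, if_false, Prod.mk.injEq] at hj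
          obtain ⟨rfl, rfl⟩ := hj
          simp
          omega

theorem encard_towerRows (b n : ℕ) :
    {L : List (ℤ × ℕ) | ∃ w, ∃ L', L = (0, w) :: L' ∧ IsTowerRows L ∧ maxRow L = b ∧
      rowsSize L = n}.encard = (∑ w ∈ Finset.Icc 1 b, convexCount b w n : ℕ) := by
  have hU : {L : List (ℤ × ℕ) | ∃ w, ∃ L', L = (0, w) :: L' ∧ IsTowerRows L ∧ maxRow L = b ∧
      rowsSize L = n} = ⋃ w ∈ Finset.Icc 1 b, runs (fun L => maxRow L = b) (0, w) n := by
    ext L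
    simp only [Set.mem_iUnion, runs, Set.mem_ofPred_eq, Finset.mem_Icc, exists_prop]
    refine exists_congr fun w => ⟨?_, fun h => h.2⟩
    rintro ⟨L, rfl, h1, h2, h3⟩
    refine ⟨⟨h1.one_le, ?_⟩, L, rfl, h1, h2, h3⟩
    rw [← h2]
    exact le_max_left _ _
  rw [hU, encard_biUnion_finset]
  · push_cast
    refine Finset.sum_congr rfl fun w hw => encard_runs_maxRow n w 0 (Finset.mem_Icc.1 hw).2
  · intro i _ j _ hij
    refine Set.disjoint_left.2 ?_
    rintro _ ⟨L, rfl, -⟩ ⟨L', h, -⟩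
    simp at h
    exact hij h.1

open PowerSeries in
theorem mk_convexCount_eq {b w : ℕ} (hw : 1 ≤ w) (hwb : w < b) :
    PowerSeries.mk (fun n => (convexCount b w n : ℚ)) =
      X ^ w * (PowerSeries.mk (fun n => (convexCount b w n : ℚ)) +
        PowerSeries.mk (fun n => (convexCount b (w + 1) n : ℚ))) := by
  ext n
  rw [coeff_X_pow_mul']
  simp only [coeff_mk, map_add]
  rw [convexCount, if_neg (by omega)]
  have h0 : ∀ v, convexCount b v 0 = 0 := by
    intro v
    have hr : rFun b 0 = 0 := by
      rw [rFun, if_pos (by omega), if_neg (by omega)]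
    have hh : hFun b 0 = 0 := by
      rw [hFun, if_pos (by omega), if_neg (by omega)]
    rw [convexCount, hr, hh]
    split_ifs <;> first | rfl | omega
  rcases lt_trichotomy n w with h | rfl | h
  · rw [if_pos (by omega), if_neg (by omega), Nat.cast_zero]
  · simp [h0]
  · rw [if_neg (by omega), if_pos (by omega)]
    push_cast
    rfl

open PowerSeries in
theorem mk_gFun_eq {b : ℕ} (hb : 2 ≤ b) :
    PowerSeries.mk (fun n => (gFun b n : ℚ)) =
      X ^ (b - 1) * (1 + PowerSeries.mk (fun n => (gFun b n : ℚ)) +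
        PowerSeries.mk (fun n => (gFun (b - 1) n : ℚ))) := by
  ext n
  rw [coeff_X_pow_mul']
  simp only [coeff_mk, map_add, coeff_one]
  rw [gFun]
  have h0 : ∀ v, gFun v 0 = 0 := by
    intro v
    rw [gFun]
    split_ifs <;> first | rfl | omega
  split_ifs with h1 h2 h3 h4 h5 h6 <;> first | omega | skip
  · simp
  · have : n - (b - 1) = 0 := by omega
    simp [this, h0]
  · have : n + 1 - b = n - (b - 1) := by omega
    rw [this]
    simp

open PowerSeries in
theorem sum_mk_convexCount (b : ℕ) (hb : 1 ≤ b) :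
    ∑ w ∈ Finset.Icc 1 b, PowerSeries.mk (fun n => (convexCount b w n : ℚ)) =
      (PowerSeries.mk (fun n => (gFun b n : ℚ)) + 1) *
        PowerSeries.mk (fun n => (convexCount b b n : ℚ)) := by
  have hunit : ∀ j, 1 ≤ j → (1 - X ^ j : PowerSeries ℚ) ≠ 0 := by
    intro j hj h
    have := congrArg constantCoeff h
    simp [show j ≠ 0 by omega] at this
  set M : ℕ → PowerSeries ℚ := fun w => PowerSeries.mk (fun n => (convexCount b w n : ℚ))
  set G : ℕ → PowerSeries ℚ := fun c => PowerSeries.mk (fun n => (gFun c n : ℚ)) with hG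
  have hrec : ∀ w, 1 ≤ w → w < b → (1 - X ^ w) * M w = X ^ w * M (w + 1) := by
    intro w hw hwb
    have : M w = X ^ w * (M w + M (w + 1)) := mk_convexCount_eq hw hwb
    linear_combination this
  have hsum : ∀ c, 1 ≤ c → c ≤ b → ∑ w ∈ Finset.Icc 1 c, M w = (G c + 1) * M c := by
    intro c hc
    induction c, hc using Nat.le_induction with
    | base =>
      intro _
      have : G 1 = 0 := by
        ext n
        have : gFun 1 n = 0 := by
          rw [gFun]
          simp
        simp [hG, this]
      simp [this]
    | succ c hc ih =>
      intro hcb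
      rw [Finset.sum_Icc_succ_top (by omega), ih (by omega)]
      have h1 : G (c + 1) = X ^ c * (1 + G (c + 1) + G c) := mk_gFun_eq (by omega)
      refine mul_left_cancel₀ (hunit c hc) ?_
      linear_combination (G c + 1) * hrec c hc (by omega) - M (c + 1) * h1
  exact hsum b hb le_rfl

/-- The configuration with `R` as row at level `0` and `D` moved up by one level on top of it. -/
def consRow (R : ℤ × ℕ) (D : Finset (ℤ × ℕ)) : Finset (ℤ × ℕ) :=
  (Finset.range R.2).image (fun t : ℕ => (R.1 + 2 * (t : ℤ), 0)) ∪
    D.image fun p => (p.1, p.2 + 1)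

/-- The dominoes of a list of rows. -/
def towerOf : List (ℤ × ℕ) → Finset (ℤ × ℕ)
  | [] => ∅
  | R :: L => consRow R (towerOf L)

/-- The row of `D` at level `0` is `R`. -/
def HasBase (R : ℤ × ℕ) (D : Finset (ℤ × ℕ)) : Prop :=
  ∀ x : ℤ, (x, 0) ∈ D ↔ ∃ t : ℕ, t < R.2 ∧ x = R.1 + 2 * t

theorem hasBase_consRow (R : ℤ × ℕ) (D : Finset (ℤ × ℕ)) : HasBase R (consRow R D) := by
  intro x
  simp [consRow, eq_comm]

theorem mem_consRow_succ {R : ℤ × ℕ} {D : Finset (ℤ × ℕ)} {x : ℤ} {y : ℕ} :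
    (x, y + 1) ∈ consRow R D ↔ (x, y) ∈ D := by
  simp [consRow]

theorem covered_consRow_succ {R : ℤ × ℕ} {D : Finset (ℤ × ℕ)} {x : ℤ} {y : ℕ} :
    Covered (consRow R D) x (y + 1) ↔ Covered D x y := by
  simp [Covered, mem_consRow_succ]

theorem HasBase.covered_iff {R : ℤ × ℕ} {D : Finset (ℤ × ℕ)} (h : HasBase R D) {x : ℤ} :
    Covered D x 0 ↔ R.1 ≤ x ∧ x < R.1 + 2 * R.2 := by
  rw [Covered, h, h]
  constructor
  · rintro (⟨t, ht, hx⟩ | ⟨t, ht, hx⟩) <;> omega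
  · rintro ⟨h1, h2⟩
    rcases Int.emod_two_eq_zero_or_one (x - R.1) with hp | hp
    · exact Or.inl ⟨((x - R.1) / 2).toNat, by omega, by omega⟩
    · exact Or.inr ⟨((x - R.1) / 2).toNat, by omega, by omega⟩

theorem HasBase.ext {R S : ℤ × ℕ} {D : Finset (ℤ × ℕ)} (hR : HasBase R D) (hS : HasBase S D)
    (hR1 : 1 ≤ R.2) (hS1 : 1 ≤ S.2) : R = S := by
  have h : ∀ x : ℤ, R.1 ≤ x ∧ x < R.1 + 2 * R.2 ↔ S.1 ≤ x ∧ x < S.1 + 2 * S.2 := fun x =>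
    hR.covered_iff.symm.trans hS.covered_iff
  have h1 := h R.1
  have h2 := h S.1
  have h3 := h (R.1 + 2 * R.2 - 1)
  have h4 := h (S.1 + 2 * S.2 - 1)
  ext <;> omega

/-- A convex domino tower whose lowest row is `R`. -/
structure IsTowerOn (R : ℤ × ℕ) (D : Finset (ℤ × ℕ)) : Prop where
  pos : 1 ≤ R.2
  noOverlap : NoOverlap D
  supported : Supported D
  hasBase : HasBase R D
  row_convex : ∀ (x₁ x₂ x : ℤ) (y : ℕ), Covered D x₁ y → Covered D x₂ y → x₁ ≤ x → x ≤ x₂ →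
    Covered D x y
  column_convex : ∀ (x : ℤ) (y₁ y₂ y : ℕ), Covered D x y₁ → Covered D x y₂ → y₁ ≤ y → y ≤ y₂ →
    Covered D x y

theorem HasBase.noOverlap {R : ℤ × ℕ} {D : Finset (ℤ × ℕ)} (h : HasBase R D) {x : ℤ}
    (hx : (x, 0) ∈ D) : (x + 1, 0) ∉ D := by
  rw [h] at hx ⊢
  rintro ⟨t, -, ht⟩
  obtain ⟨s, -, hs⟩ := hx
  omega

theorem HasBase.supports {R : ℤ × ℕ} {D : Finset (ℤ × ℕ)} (h : HasBase R D) {x : ℤ}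
    (h1 : R.1 ≤ x + 1) (h2 : x + 2 ≤ R.1 + 2 * R.2 + 1) (hR : 1 ≤ R.2) :
    (x - 1, 0) ∈ D ∨ (x, 0) ∈ D ∨ (x + 1, 0) ∈ D := by
  rw [h, h, h]
  rcases Int.emod_two_eq_zero_or_one (x - R.1) with hp | hp
  · exact Or.inr (Or.inl ⟨((x - R.1) / 2).toNat, by omega, by omega⟩)
  · rcases h1.eq_or_lt with h3 | h3
    · exact Or.inr (Or.inr ⟨0, by omega, by omega⟩)
    · exact Or.inl ⟨((x - R.1) / 2).toNat, by omega, by omega⟩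

/-- A sufficient condition for putting a tower on a new lowest row. -/
theorem IsTowerOn.cons {R S : ℤ × ℕ} {D : Finset (ℤ × ℕ)} (h : IsTowerOn S D)
    (hR : 1 ≤ R.2) (h1 : R.1 ≤ S.1 + 1) (h2 : S.1 + 2 * S.2 ≤ R.1 + 2 * R.2 + 1)
    (h3 : ∀ x y, Covered D x y → R.1 ≤ x → x < R.1 + 2 * R.2 → S.1 ≤ x ∧ x < S.1 + 2 * S.2) :
    IsTowerOn R (consRow R D) := by
  have hb := hasBase_consRow R D
  refine ⟨hR, ?_, ?_, hb, ?_, ?_⟩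
  · rintro ⟨x, _ | y⟩ hx
    · exact hb.noOverlap hx
    · rw [mem_consRow_succ] at hx ⊢
      exact h.noOverlap _ hx
  · rintro x (_ | y) hx
    · rw [mem_consRow_succ, h.hasBase] at hx
      obtain ⟨t, ht, hx⟩ := hx
      exact hb.supports (by omega) (by omega) hR
    · simp only [mem_consRow_succ] at hx ⊢
      exact h.supported x y hx
  · rintro x₁ x₂ x (_ | y) hx₁ hx₂ h₁ h₂
    · rw [hb.covered_iff] at *
      omega
    · rw [covered_consRow_succ] at *
      exact h.row_convex x₁ x₂ x y hx₁ hx₂ h₁ h₂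
  · rintro x y₁ (_ | y₂) (_ | y) hx₁ hx₂ h₁ h₂
    · exact hx₂
    · omega
    · rwa [Nat.le_zero.1 h₁] at hx₁
    · rw [covered_consRow_succ] at hx₂ ⊢
      rcases y₁ with _ | y₁
      · rw [hb.covered_iff] at hx₁
        exact h.column_convex x 0 y₂ y (h.hasBase.covered_iff.2 (h3 x y₂ hx₂ hx₁.1 hx₁.2)) hx₂
          (Nat.zero_le _) (by omega)
      · rw [covered_consRow_succ] at hx₁
        exact h.column_convex x y₁ y₂ y hx₁ hx₂ (by omega) (by omega)

theorem isTowerOn_singleton {R : ℤ × ℕ} (hR : 1 ≤ R.2) : IsTowerOn R (consRow R ∅) := by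
  have hb := hasBase_consRow R ∅
  have hne : ∀ x y, ¬Covered (consRow R ∅) x (y + 1) := by
    intro x y h
    rw [covered_consRow_succ] at h
    simp [Covered] at h
  refine ⟨hR, ?_, ?_, hb, ?_, ?_⟩
  · rintro ⟨x, _ | y⟩ hx
    · exact hb.noOverlap hx
    · simp [mem_consRow_succ] at hx
  · rintro x y hx
    simp [mem_consRow_succ] at hx
  · rintro x₁ x₂ x (_ | y) hx₁ hx₂ h₁ h₂
    · rw [hb.covered_iff] at *
      omega
    · exact absurd hx₁ (hne _ _)
  · rintro x y₁ (_ | y₂) y hx₁ hx₂ h₁ h₂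
    · rwa [Nat.le_zero.1 h₂]
    · exact absurd hx₂ (hne _ _)

theorem IsTowerRows.isTowerOn {R : ℤ × ℕ} {L : List (ℤ × ℕ)} (h : IsTowerRows (R :: L)) :
    IsTowerOn R (towerOf (R :: L)) ∧
      (∀ x y, Covered (towerOf (R :: L)) x y → x < R.1 → OverhangsLeft (R :: L)) ∧
      (∀ x y, Covered (towerOf (R :: L)) x y → R.1 + 2 * R.2 ≤ x → OverhangsRight (R :: L)) := by
  induction L generalizing R with
  | nil =>
    have hb := hasBase_consRow R ∅
    refine ⟨isTowerOn_singleton h, ?_, ?_⟩ <;>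
    · rintro x (_ | y) hx h1
      · rw [towerOf, towerOf, hb.covered_iff] at hx
        omega
      · rw [towerOf, towerOf, covered_consRow_succ] at hx
        simp [Covered] at hx
  | cons S L ih =>
    obtain ⟨h1, h2, h3, h4, h5, h6⟩ := h
    obtain ⟨hS, hl, hr⟩ := ih h6
    rw [towerOf]
    have hb := hasBase_consRow R (towerOf (S :: L))
    refine ⟨hS.cons h1 h2 h3 fun x y hx hx1 hx2 => ⟨?_, ?_⟩, ?_, ?_⟩
    · by_contra! hc
      have := h4 (hl x y hx hc)
      omega
    · by_contra! hc
      have := h5 (hr x y hx hc)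
      omega
    · rintro x (_ | y) hx hxR
      · rw [hb.covered_iff] at hx
        omega
      · rw [covered_consRow_succ] at hx
        by_cases hc : x < S.1
        · exact Or.inr (hl x y hx hc)
        · exact Or.inl (by omega)
    · rintro x (_ | y) hx hxR
      · rw [hb.covered_iff] at hx
        omega
      · rw [covered_consRow_succ] at hx
        by_cases hc : x < S.1 + 2 * S.2
        · exact Or.inl (by omega)
        · exact Or.inr (hr x y hx (by omega))

theorem IsTowerRows.exists_covered {R : ℤ × ℕ} {L : List (ℤ × ℕ)} (h : IsTowerRows (R :: L)) :
    (OverhangsLeft (R :: L) → ∃ y, Covered (towerOf (R :: L)) (R.1 - 1) y) ∧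
      (OverhangsRight (R :: L) → ∃ y, Covered (towerOf (R :: L)) (R.1 + 2 * R.2) y) := by
  induction L generalizing R with
  | nil => exact ⟨False.elim, False.elim⟩
  | cons S L ih =>
    obtain ⟨h1, h2, h3, h4, h5, h6⟩ := h
    obtain ⟨hl, hr⟩ := ih h6
    have hS := h6.isTowerOn.1
    have hpos := hS.pos
    rw [towerOf]
    constructor
    · intro h
      by_cases hc : S.1 < R.1
      · refine ⟨1, covered_consRow_succ.2 (hS.hasBase.covered_iff.2 ?_)⟩
        omega
      · have h := h.resolve_left hc
        obtain ⟨y, hy⟩ := hl h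
        have := h4 h
        refine ⟨y + 1, covered_consRow_succ.2 ?_⟩
        rwa [show R.1 = S.1 by omega]
    · intro h
      by_cases hc : R.1 + 2 * R.2 < S.1 + 2 * S.2
      · refine ⟨1, covered_consRow_succ.2 (hS.hasBase.covered_iff.2 ?_)⟩
        omega
      · have h := h.resolve_left hc
        obtain ⟨y, hy⟩ := hr h
        have := h5 h
        refine ⟨y + 1, covered_consRow_succ.2 ?_⟩
        rwa [show R.1 + 2 * R.2 = S.1 + 2 * S.2 by omega]

theorem exists_eq_consRow {R : ℤ × ℕ} {D : Finset (ℤ × ℕ)} (h : HasBase R D) :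
    ∃ D', D = consRow R D' := by
  refine ⟨(D.filter fun p => p.2 ≠ 0).image fun p => (p.1, p.2 - 1), ?_⟩
  ext ⟨x, _ | y⟩
  · rw [h, hasBase_consRow R]
  · rw [mem_consRow_succ]
    simp only [Finset.mem_image, Finset.mem_filter, Prod.mk.injEq, Prod.exists]
    constructor
    · intro hx
      exact ⟨x, y + 1, ⟨hx, by simp⟩, rfl, rfl⟩
    · rintro ⟨x', y', ⟨h1, h2⟩, rfl, rfl⟩
      rwa [Nat.sub_add_cancel (Nat.pos_of_ne_zero h2)]

theorem Supported.exists_mem_zero {D : Finset (ℤ × ℕ)} (h : Supported D) (hD : D.Nonempty) :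
    ∃ x, (x, 0) ∈ D := by
  obtain ⟨⟨x, y⟩, hx⟩ := hD
  induction y generalizing x with
  | zero => exact ⟨x, hx⟩
  | succ y ih =>
    rcases h x y hx with h | h | h
    exacts [ih _ h, ih _ h, ih _ h]

theorem exists_hasBase {D : Finset (ℤ × ℕ)} (hD : ∃ x, (x, 0) ∈ D) (h1 : NoOverlap D)
    (h2 : ∀ (x₁ x₂ x : ℤ), Covered D x₁ 0 → Covered D x₂ 0 → x₁ ≤ x → x ≤ x₂ → Covered D x 0) :
    ∃ S, 1 ≤ S.2 ∧ HasBase S D := by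
  have hmem : ∀ x, x ∈ (D.filter fun p => p.2 = 0).image Prod.fst ↔ (x, 0) ∈ D := by
    intro x
    simp
  have hne : ((D.filter fun p => p.2 = 0).image Prod.fst).Nonempty :=
    hD.imp fun x hx => (hmem x).2 hx
  obtain ⟨a, ha, hmin⟩ := Finset.exists_min_image _ id hne
  obtain ⟨m, hm, hmax⟩ := Finset.exists_max_image _ id hne
  simp only [hmem, id] at ha hm hmin hmax
  have hall : ∀ t : ℕ, a + 2 * t ≤ m → (a + 2 * (t : ℤ), 0) ∈ D := by
    intro t
    induction t with
    | zero => intro _; simpa using ha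
    | succ t ih =>
      intro ht
      push_cast at ht ⊢
      have hmem := ih (by omega)
      rcases h2 a m (a + 2 * (t + 1)) (Or.inl ha) (Or.inl hm) (by omega) ht with h | h
      · exact h
      · refine absurd ?_ (h1 _ hmem)
        rwa [show a + 2 * (t : ℤ) + 1 = a + 2 * (t + 1) - 1 by ring]
  refine ⟨(a, ((m - a) / 2).toNat + 1), by simp, fun x => ⟨fun hx => ?_, ?_⟩⟩
  · have hax := hmin x hx
    have hxm := hmax x hx
    refine ⟨((x - a) / 2).toNat, by dsimp only; omega, ?_⟩
    by_contra hodd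
    refine absurd ?_ (h1 _ (hall ((x - a) / 2).toNat (by omega)))
    dsimp only at hodd ⊢
    rwa [show a + 2 * (((x - a) / 2).toNat : ℤ) + 1 = x by omega]
  · rintro ⟨t, ht, rfl⟩
    have := hmin m hm
    exact hall t (by dsimp only at ht; omega)

theorem IsTowerOn.exists_of_consRow {R : ℤ × ℕ} {D : Finset (ℤ × ℕ)}
    (h : IsTowerOn R (consRow R D)) (hD : D.Nonempty) : ∃ S, IsTowerOn S D := by
  have h1 : NoOverlap D := fun p hp => by
    have := h.noOverlap (p.1, p.2 + 1) (mem_consRow_succ.2 hp)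
    rwa [mem_consRow_succ] at this
  have h2 : Supported D := fun x y hx => by
    have := h.supported x (y + 1) (mem_consRow_succ.2 hx)
    simpa only [mem_consRow_succ] using this
  have h3 : ∀ (x₁ x₂ x : ℤ) (y : ℕ), Covered D x₁ y → Covered D x₂ y → x₁ ≤ x → x ≤ x₂ →
      Covered D x y := fun x₁ x₂ x y => by
    simpa only [covered_consRow_succ] using h.row_convex x₁ x₂ x (y + 1)
  obtain ⟨S, hS, hb⟩ := exists_hasBase (h2.exists_mem_zero hD) h1 fun x₁ x₂ x => h3 x₁ x₂ x 0
  refine ⟨S, hS, h1, h2, hb, h3, fun x y₁ y₂ y hx₁ hx₂ hy₁ hy₂ => ?_⟩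
  exact covered_consRow_succ.1 (h.column_convex x (y₁ + 1) (y₂ + 1) (y + 1)
    (covered_consRow_succ.2 hx₁) (covered_consRow_succ.2 hx₂) (by omega) (by omega))

theorem IsTowerOn.exists_rows {R : ℤ × ℕ} {D : Finset (ℤ × ℕ)} (h : IsTowerOn R D) :
    ∃ L, IsTowerRows (R :: L) ∧ towerOf (R :: L) = D := by
  induction hn : D.card using Nat.strong_induction_on generalizing R D with
  | _ n ih =>
  obtain ⟨D, rfl⟩ := exists_eq_consRow h.hasBase
  have hpos := h.pos
  rcases D.eq_empty_or_nonempty with rfl | hD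
  · exact ⟨[], hpos, rfl⟩
  · obtain ⟨S, hS⟩ := h.exists_of_consRow hD
    have hlt : D.card < n := by
      rw [← hn, ← Finset.card_image_of_injective D
        (show Function.Injective fun p : ℤ × ℕ => (p.1, p.2 + 1) by
          rintro ⟨x, y⟩ ⟨x', y'⟩ h
          simpa using h)]
      refine Finset.card_lt_card (Finset.ssubset_iff_of_subset Finset.subset_union_right |>.2
        ⟨(R.1, 0), (h.hasBase R.1).2 ⟨0, hpos, by simp⟩, by simp⟩)
    obtain ⟨L, hL, rfl⟩ := ih _ hlt hS rfl
    have hSpos := hS.pos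
    have hsupp : ∀ x, (x, 0) ∈ towerOf (S :: L) → R.1 ≤ x + 1 ∧ x + 2 ≤ R.1 + 2 * R.2 + 1 := by
      intro x hx
      have := h.supported x 0 (mem_consRow_succ.2 hx)
      rw [h.hasBase, h.hasBase, h.hasBase] at this
      rcases this with ⟨t, ht, hx⟩ | ⟨t, ht, hx⟩ | ⟨t, ht, hx⟩ <;> omega
    have hleft := hsupp S.1 ((hS.hasBase _).2 ⟨0, hSpos, by simp⟩)
    have hright := hsupp _ ((hS.hasBase _).2 ⟨S.2 - 1, by omega, rfl⟩)
    have hcov : ∀ x y, Covered (towerOf (S :: L)) x y → R.1 ≤ x → x < R.1 + 2 * R.2 →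
        S.1 ≤ x ∧ x < S.1 + 2 * S.2 := by
      intro x y hx h1 h2
      rw [← hS.hasBase.covered_iff, ← covered_consRow_succ (R := R)]
      exact h.column_convex x 0 (y + 1) 1 (h.hasBase.covered_iff.2 ⟨h1, h2⟩)
        (covered_consRow_succ.2 hx) (by omega) (by omega)
    refine ⟨S :: L, ⟨hpos, hleft.1, by omega, fun hl => ?_, fun hr => ?_, hL⟩, rfl⟩
    · obtain ⟨y, hy⟩ := hL.exists_covered.1 hl
      by_contra! hc
      have := hcov _ _ hy
      omega
    · obtain ⟨y, hy⟩ := hL.exists_covered.2 hr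
      by_contra! hc
      have := hcov _ _ hy
      omega

theorem IsTowerRows.towerOf_inj {R S : ℤ × ℕ} {L M : List (ℤ × ℕ)} (hL : IsTowerRows (R :: L))
    (hM : IsTowerRows (S :: M)) (h : towerOf (R :: L) = towerOf (S :: M)) : R :: L = S :: M := by
  induction L generalizing R S M with
  | nil =>
    obtain rfl := hL.isTowerOn.1.hasBase.ext (h ▸ hM.isTowerOn.1.hasBase) hL.one_le hM.one_le
    cases M with
    | nil => rfl
    | cons T M =>
      have hT := hM.2.2.2.2.2.isTowerOn.1
      have hmem := (mem_consRow_succ (R := R)).2 ((hT.hasBase T.1).2 ⟨0, hT.pos, by simp⟩)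
      rw [← towerOf, ← h, towerOf, mem_consRow_succ] at hmem
      simp [towerOf] at hmem
  | cons U L ih =>
    obtain rfl := hL.isTowerOn.1.hasBase.ext (h ▸ hM.isTowerOn.1.hasBase) hL.one_le hM.one_le
    cases M with
    | nil =>
      have hT := hL.2.2.2.2.2.isTowerOn.1
      have hmem := (mem_consRow_succ (R := R)).2 ((hT.hasBase U.1).2 ⟨0, hT.pos, by simp⟩)
      rw [← towerOf, h, towerOf, mem_consRow_succ] at hmem
      simp [towerOf] at hmem
    | cons T M =>
      rw [ih hL.2.2.2.2.2 hM.2.2.2.2.2]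
      ext ⟨x, y⟩
      rw [← mem_consRow_succ (R := R), ← towerOf, h, towerOf, mem_consRow_succ]

theorem card_towerOf (L : List (ℤ × ℕ)) : (towerOf L).card = rowsSize L := by
  induction L with
  | nil => rfl
  | cons R L ih =>
    rw [towerOf, rowsSize, consRow, Finset.card_union_of_disjoint, Finset.card_image_of_injective,
      Finset.card_image_of_injective, ih, Finset.card_range]
    · rintro ⟨x, y⟩ ⟨x', y'⟩ h
      simpa using h
    · intro s t h
      simpa using h
    · rw [Finset.disjoint_left]
      simp

theorem mem_rowSet {D : Finset (ℤ × ℕ)} {x : ℤ} {y : ℕ} : x ∈ rowSet D y ↔ (x, y) ∈ D := by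
  simp [rowSet]

theorem card_rowSet_consRow_zero (R : ℤ × ℕ) (D : Finset (ℤ × ℕ)) :
    (rowSet (consRow R D) 0).card = R.2 := by
  have : rowSet (consRow R D) 0 =
      (Finset.range R.2).image fun t : ℕ => R.1 + 2 * (t : ℤ) := by
    ext x
    rw [mem_rowSet, hasBase_consRow R]
    simp [eq_comm]
  rw [this, Finset.card_image_of_injective, Finset.card_range]
  intro s t h
  simpa using h

theorem rowSet_consRow_succ (R : ℤ × ℕ) (D : Finset (ℤ × ℕ)) (y : ℕ) :
    rowSet (consRow R D) (y + 1) = rowSet D y := by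
  ext x
  rw [mem_rowSet, mem_rowSet, mem_consRow_succ]

theorem card_rowSet_le_maxRow (L : List (ℤ × ℕ)) (y : ℕ) :
    (rowSet (towerOf L) y).card ≤ maxRow L := by
  induction L generalizing y with
  | nil => simp [towerOf, rowSet]
  | cons R L ih =>
    cases y with
    | zero => exact (card_rowSet_consRow_zero R _).le.trans (le_max_left _ _)
    | succ y =>
      rw [towerOf, rowSet_consRow_succ]
      exact (ih y).trans (le_max_right _ _)

theorem exists_card_rowSet_eq_maxRow (L : List (ℤ × ℕ)) :
    ∃ y, (rowSet (towerOf L) y).card = maxRow L := by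
  induction L with
  | nil => exact ⟨0, by simp [towerOf, rowSet, maxRow]⟩
  | cons R L ih =>
    rw [maxRow]
    rcases max_choice R.2 (maxRow L) with h | h <;> rw [h]
    · exact ⟨0, card_rowSet_consRow_zero R _⟩
    · obtain ⟨y, hy⟩ := ih
      exact ⟨y + 1, by rw [towerOf, rowSet_consRow_succ, hy]⟩

theorem maxRow_eq_iff (L : List (ℤ × ℕ)) (b : ℕ) :
    maxRow L = b ↔ (∃ y, (rowSet (towerOf L) y).card = b) ∧
      ∀ y, (rowSet (towerOf L) y).card ≤ b := by
  constructor
  · rintro rfl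
    exact ⟨exists_card_rowSet_eq_maxRow L, card_rowSet_le_maxRow L⟩
  · rintro ⟨⟨y, rfl⟩, h⟩
    obtain ⟨z, hz⟩ := exists_card_rowSet_eq_maxRow L
    exact le_antisymm (hz ▸ h z) (card_rowSet_le_maxRow L y)

theorem isConvexDominoTower_iff (n b : ℕ) (D : Finset (ℤ × ℕ)) :
    IsConvexDominoTower n b D ↔ (∃ w, IsTowerOn (0, w) D) ∧ D.card = n ∧
      (∃ y, (rowSet D y).card = b) ∧ ∀ y, (rowSet D y).card ≤ b := by
  have hbase : ∀ w, HasBase (0, w) D ↔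
      rowSet D 0 = (Finset.range w).image fun t : ℕ => 2 * (t : ℤ) := by
    intro w
    rw [Finset.ext_iff]
    refine forall_congr' fun x => ?_
    rw [mem_rowSet]
    simp [eq_comm]
  constructor
  · rintro ⟨h1, h2, h3, ⟨w, hw, h4⟩, h5, h6, h7⟩
    exact ⟨⟨w, hw, h2, h3, (hbase w).2 h4, h5, h6⟩, h1, h7⟩
  · rintro ⟨⟨w, hw, h2, h3, h4, h5, h6⟩, h1, h7⟩
    exact ⟨h1, h2, h3, ⟨w, hw, (hbase w).1 h4⟩, h5, h6, h7⟩

theorem ncard_isConvexDominoTower (n b : ℕ) :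
    {D : Finset (ℤ × ℕ) | IsConvexDominoTower n b D}.ncard =
      ∑ w ∈ Finset.Icc 1 b, convexCount b w n := by
  have hU : {D : Finset (ℤ × ℕ) | IsConvexDominoTower n b D} =
      towerOf '' {L : List (ℤ × ℕ) | ∃ w, ∃ L', L = (0, w) :: L' ∧ IsTowerRows L ∧
        maxRow L = b ∧ rowsSize L = n} := by
    ext D
    simp only [Set.mem_ofPred_eq, Set.mem_image, isConvexDominoTower_iff]
    constructor
    · rintro ⟨⟨w, hw⟩, rfl, h⟩
      obtain ⟨L, hL, rfl⟩ := hw.exists_rows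
      exact ⟨_, ⟨w, L, rfl, hL, (maxRow_eq_iff _ _).2 h, (card_towerOf _).symm⟩, rfl⟩
    · rintro ⟨_, ⟨w, L, rfl, hL, hb, hn⟩, rfl⟩
      exact ⟨⟨w, hL.isTowerOn.1⟩, (card_towerOf _).trans hn, (maxRow_eq_iff _ _).1 hb⟩
  rw [hU, Set.ncard_def, Set.InjOn.encard_image, encard_towerRows, ENat.toNat_natCast]
  rintro _ ⟨w, L, rfl, hL, -⟩ _ ⟨v, M, rfl, hM, -⟩ h
  exact hL.towerOf_inj hM h

/-- The generating function for convex `(n,b)`-domino towers (widest row of `b` dominoes)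
factors as `C_b(x) = (G_b(x) + 1)(2R_b(x) + H_b(x))`, where `G_b`, `R_b`, `H_b` are the
generating functions of supporting towers, right- (or left-) skewed towers, and domino
stacks, respectively. -/
theorem convex_tower_genFun (b : ℕ) (hb : 1 ≤ b) :
    PowerSeries.mk
        (fun n => (({D : Finset (ℤ × ℕ) | IsConvexDominoTower n b D}.ncard : ℚ))) =
      (PowerSeries.mk (fun n => (gFun b n : ℚ)) + 1) *
        (2 * PowerSeries.mk (fun n => (rFun b n : ℚ)) +
          PowerSeries.mk (fun n => (hFun b n : ℚ))) := by
  have hC : PowerSeries.mk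
      (fun n => (({D : Finset (ℤ × ℕ) | IsConvexDominoTower n b D}.ncard : ℚ))) =
        ∑ w ∈ Finset.Icc 1 b, PowerSeries.mk (fun n => (convexCount b w n : ℚ)) := by
    ext n
    simp [ncard_isConvexDominoTower]
  have hU : PowerSeries.mk (fun n => (convexCount b b n : ℚ)) =
      2 * PowerSeries.mk (fun n => (rFun b n : ℚ)) +
        PowerSeries.mk (fun n => (hFun b n : ℚ)) := by
    ext n
    rw [two_mul]
    simp only [map_add, PowerSeries.coeff_mk]
    rw [convexCount, if_pos rfl]
    push_cast
    ring
  rw [hC, sum_mk_convexCount b hb, hU]
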